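/- Let k ≥ 1 and let t be a nonempty ordinal tree. Let ϑ^t be the empirical kth-order shape process of the full binary tree FCNS⋄(t) and let ζ^{ϑ^t} be its derived (k−1)st-order childtype process. Then H_k^s(t) = log₂(1/P_{ζ^{ϑ^t}}[t]), where P_{ζ^{ϑ^t}}[t] := P_{ζ^{ϑ^t}}[FCNS⋄(t)]. -/

import Mathlib

inductive BinTree : Type where
  | leaf : BinTree
  | node : BinTree → BinTree → BinTree
deriving DecidableEq

/-- Update a length-`k` shape-history by appending the newest direction and
dropping the oldest one. -/
def pushDir (z : List Bool) (b : Bool) : List Bool := (z ++ [b]).tail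

/-- `shapeProbAux ϑ t z` = product over all nodes `v` of the full binary tree
`t` of `ϑ (k-shape-history of v) (type v)`, where `z` is the k-shape-history
of the root and type is 0 for a leaf and 2 for an inner node.
(Here `BinTree.leaf` is a *leaf node*: `BinTree` is exactly the type of full
binary trees.) -/
noncomputable def shapeProbAux (ϑ : List Bool → ℕ → ℝ) : BinTree → List Bool → ℝ
  | .leaf, z => ϑ z 0
  | .node l r, z =>
      ϑ z 2 * shapeProbAux ϑ l (pushDir z false) * shapeProbAux ϑ r (pushDir z true)

/-- Probability assigned to a full binary tree by a kth-order shape process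
(shape-histories of too-shallow nodes are padded with 0's, i.e. `false`). -/
noncomputable def shapeProb (k : ℕ) (ϑ : List Bool → ℕ → ℝ) (t : BinTree) : ℝ :=
  shapeProbAux ϑ t (List.replicate k false)

/-- The childtype of an inner node with subtrees `l`, `r`: 0 if both children
are leaves, 1 if only the left child is a leaf, 2 if only the right child is
a leaf, 3 if both children are inner nodes. -/
def childtype : BinTree → BinTree → ℕ
  | .leaf, .leaf => 0
  | .leaf, .node _ _ => 1
  | .node _ _, .leaf => 2
  | .node _ _, .node _ _ => 3

/-- Product over all inner nodes `v` of `ζ (j-shape-history of v) (childtype v)`,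
where `z` is the j-shape-history of the root. -/
noncomputable def childtypeProbAux (ζ : List Bool → ℕ → ℝ) : BinTree → List Bool → ℝ
  | .leaf, _ => 1
  | .node l r, z =>
      ζ z (childtype l r) * childtypeProbAux ζ l (pushDir z false) *
        childtypeProbAux ζ r (pushDir z true)

/-- Probability assigned to a full binary tree by a jth-order childtype
process `(nz, ζ)`: `1 - nz` for the single-node tree, and
`nz · ∏_{inner v} ζ_{h_j^s(v)}(childtype v)` otherwise. -/
noncomputable def childtypeProb (j : ℕ) (nz : ℝ) (ζ : List Bool → ℕ → ℝ) :
    BinTree → ℝ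
  | .leaf => 1 - nz
  | .node l r => nz * childtypeProbAux ζ (.node l r) (List.replicate j false)

/-- The (k−1)st-order childtype process derived from a kth-order shape process
`ϑ` (this is the `ζ^ϑ` part; the `n_ζ` part is `ϑ 0^k 2`). -/
noncomputable def derivedZeta (ϑ : List Bool → ℕ → ℝ) (z : List Bool) : ℕ → ℝ
  | 0 => ϑ (z ++ [false]) 0 * ϑ (z ++ [true]) 0
  | 1 => ϑ (z ++ [false]) 0 * ϑ (z ++ [true]) 2
  | 2 => ϑ (z ++ [false]) 2 * ϑ (z ++ [true]) 0
  | 3 => ϑ (z ++ [false]) 2 * ϑ (z ++ [true]) 2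
  | _ => 0

/-- Ordinal trees: a root node with a finite (possibly empty) list of
ordinal subtrees. -/
inductive OrdTree : Type where
  | node : List OrdTree → OrdTree

/-- The modified first-child next-sibling encoding `FCNS⋄`, mapping ordinal
forests bijectively to full binary trees; `BinTree.leaf` plays the role of
the single-node full binary tree. -/
def fcnsStar : List OrdTree → BinTree
  | [] => .leaf
  | OrdTree.node f :: g => .node (fcnsStar f) (fcnsStar g)

/-- `countHistAux t h z i` counts the nodes of `t` with k-shape-history `z`
and type `i` (0 = leaf, 2 = inner), where `h` is the k-shape-history of the
root of `t`. -/
def countHistAux : BinTree → List Bool → List Bool → ℕ → ℕ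
  | .leaf, h, z, i => if h = z ∧ i = 0 then 1 else 0
  | .node l r, h, z, i =>
      (if h = z ∧ i = 2 then 1 else 0) + countHistAux l (pushDir h false) z i +
        countHistAux r (pushDir h true) z i

/-- `m_{z,i}^t`: the number of nodes of `t` with k-shape-history `z` and
type `i`. -/
def mCount (k : ℕ) (t : BinTree) (z : List Bool) (i : ℕ) : ℕ :=
  countHistAux t (List.replicate k false) z i

/-- The kth-order shape entropy
`H_k^s(t) = ∑_{z∈{0,1}^k} ∑_{i∈{0,2}} m_{z,i} · lg (m_z / m_{z,i})`
of a full binary tree (convention `0 · lg (x/0) = 0`, automatic in Lean). -/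
noncomputable def shapeEntropy (k : ℕ) (t : BinTree) : ℝ :=
  ∑ f : Fin k → Bool,
    ((mCount k t (List.ofFn f) 0 : ℝ) *
        Real.logb 2
          (((mCount k t (List.ofFn f) 0 + mCount k t (List.ofFn f) 2 : ℕ) : ℝ) /
            (mCount k t (List.ofFn f) 0 : ℝ)) +
      (mCount k t (List.ofFn f) 2 : ℝ) *
        Real.logb 2
          (((mCount k t (List.ofFn f) 0 + mCount k t (List.ofFn f) 2 : ℕ) : ℝ) /
            (mCount k t (List.ofFn f) 2 : ℝ)))

/-- The empirical kth-order shape process of a full binary tree `t`: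
`ϑ^t_z(i) = m_{z,i}/m_z`, and `ϑ^t_z(0) = 1` when `m_z = 0`. -/
noncomputable def empShape (k : ℕ) (t : BinTree) (z : List Bool) (i : ℕ) : ℝ :=
  if mCount k t z 0 + mCount k t z 2 = 0 then (if i = 0 then 1 else 0)
  else (mCount k t z i : ℝ) / ((mCount k t z 0 + mCount k t z 2 : ℕ) : ℝ)

/-- The type of the root: 0 for a leaf and 2 for an inner node. -/
def rootType : BinTree → ℕ
  | .leaf => 0
  | .node _ _ => 2

theorem derivedZeta_childtype (ϑ : List Bool → ℕ → ℝ) (z : List Bool) (l r : BinTree) :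
    derivedZeta ϑ z (childtype l r) =
      ϑ (z ++ [false]) (rootType l) * ϑ (z ++ [true]) (rootType r) := by
  cases l <;> cases r <;> rfl

theorem pushDir_eq (h : List Bool) (hh : h ≠ []) (b : Bool) : pushDir h b = h.tail ++ [b] := by
  cases h with
  | nil => exact absurd rfl hh
  | cons a s => rfl

theorem shapeProbAux_eq (ϑ : List Bool → ℕ → ℝ) (t : BinTree) (h : List Bool) (hh : h ≠ []) :
    shapeProbAux ϑ t h =
      ϑ h (rootType t) * childtypeProbAux (derivedZeta ϑ) t h.tail := by
  induction t generalizing h with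
  | leaf => simp [shapeProbAux, childtypeProbAux, rootType]
  | node l r ihl ihr =>
    have hp : ∀ b, pushDir h b ≠ [] := fun b => by simp [pushDir_eq h hh b]
    have hq : ∀ b, pushDir h.tail b = (pushDir h b).tail := fun b => by
      rw [pushDir_eq h hh b, pushDir]
    simp only [shapeProbAux, childtypeProbAux, ihl _ (hp _), ihr _ (hp _),
      derivedZeta_childtype, hq]
    rw [← pushDir_eq h hh, ← pushDir_eq h hh]
    simp only [rootType]
    ring

theorem sum_hist (k : ℕ) (h : List Bool) (hh : h.length = k) (g : List Bool → ℝ) :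
    ∑ f : Fin k → Bool, (if h = List.ofFn f then g (List.ofFn f) else 0) = g h := by
  subst hh
  rw [Finset.sum_eq_single h.get]
  · simp
  · intro f _ hf
    rw [if_neg]
    intro e
    apply hf
    apply List.ofFn_injective
    rw [← e]; simp
  · simp

theorem logb_shapeProbAux (k : ℕ) (hk : 1 ≤ k) (ϑ : List Bool → ℕ → ℝ) (t : BinTree)
    (h : List Bool) (hh : h.length = k)
    (hpos : ∀ z i, countHistAux t h z i ≠ 0 → ϑ z i ≠ 0) :
    shapeProbAux ϑ t h ≠ 0 ∧
    Real.logb 2 (shapeProbAux ϑ t h) =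
      ∑ f : Fin k → Bool,
        ((countHistAux t h (List.ofFn f) 0 : ℝ) * Real.logb 2 (ϑ (List.ofFn f) 0) +
          (countHistAux t h (List.ofFn f) 2 : ℝ) * Real.logb 2 (ϑ (List.ofFn f) 2)) := by
  induction t generalizing h with
  | leaf =>
    refine ⟨hpos h 0 (by simp [countHistAux]), ?_⟩
    rw [← sum_hist k h hh (fun z => Real.logb 2 (shapeProbAux ϑ .leaf z))]
    refine Finset.sum_congr rfl fun f _ => ?_
    simp [countHistAux, shapeProbAux]
  | node l r ihl ihr =>
    have hp : ∀ b, (pushDir h b).length = k := fun b => by simp [pushDir, hh]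
    obtain ⟨nl, el⟩ := ihl (pushDir h false) (hp _)
      (fun z i hz => hpos z i (by simp only [countHistAux]; omega))
    obtain ⟨nr, er⟩ := ihr (pushDir h true) (hp _)
      (fun z i hz => hpos z i (by simp only [countHistAux]; omega))
    have n2 : ϑ h 2 ≠ 0 := hpos h 2 (by simp [countHistAux])
    refine ⟨mul_ne_zero (mul_ne_zero n2 nl) nr, ?_⟩
    rw [shapeProbAux, Real.logb_mul (mul_ne_zero n2 nl) nr, Real.logb_mul n2 nl, el, er,
      ← sum_hist k h hh (fun z => Real.logb 2 (ϑ z 2)), ← Finset.sum_add_distrib,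
      ← Finset.sum_add_distrib]
    refine Finset.sum_congr rfl fun f _ => ?_
    by_cases e : h = List.ofFn f <;> simp [countHistAux, e] <;> ring

theorem countHistAux_type (t : BinTree) (h z : List Bool) (i : ℕ)
    (hc : countHistAux t h z i ≠ 0) : i = 0 ∨ i = 2 := by
  induction t generalizing h with
  | leaf => simp [countHistAux] at hc; omega
  | node l r ihl ihr =>
    by_contra hne
    have h1 := not_imp_comm.1 (ihl (pushDir h false)) hne
    have h2 := not_imp_comm.1 (ihr (pushDir h true)) hne
    have h3 : ¬ (h = z ∧ i = 2) := by tauto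
    simp [countHistAux, h1, h2, h3] at hc

theorem empShape_ne_zero (k : ℕ) (t : BinTree) (z : List Bool) (i : ℕ)
    (hc : mCount k t z i ≠ 0) : empShape k t z i ≠ 0 := by
  have hm : mCount k t z 0 + mCount k t z 2 ≠ 0 := by
    rcases countHistAux_type _ _ _ _ hc with rfl | rfl <;> omega
  rw [empShape, if_neg hm]
  exact div_ne_zero (by exact_mod_cast hc) (by exact_mod_cast hm)

theorem mul_logb_empShape (k : ℕ) (t : BinTree) (z : List Bool) (i : ℕ) :
    (mCount k t z i : ℝ) *
        Real.logb 2 (((mCount k t z 0 + mCount k t z 2 : ℕ) : ℝ) / (mCount k t z i : ℝ)) =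
      -((mCount k t z i : ℝ) * Real.logb 2 (empShape k t z i)) := by
  by_cases hc : mCount k t z i = 0
  · simp [hc]
  have hm : mCount k t z 0 + mCount k t z 2 ≠ 0 := by
    rcases countHistAux_type _ _ _ _ hc with rfl | rfl <;> omega
  rw [empShape, if_neg hm, ← inv_div, Real.logb_inv, mul_neg]

theorem shapeEntropy_eq (k : ℕ) (hk : 1 ≤ k) (t : BinTree) :
    shapeEntropy k t = -Real.logb 2 (shapeProb k (empShape k t) t) := by
  rw [shapeProb, (logb_shapeProbAux k hk (empShape k t) t _ (by simp)
    (fun z i hz => empShape_ne_zero k t z i hz)).2, shapeEntropy, ← Finset.sum_neg_distrib]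
  refine Finset.sum_congr rfl fun f _ => ?_
  rw [mul_logb_empShape, mul_logb_empShape, neg_add]
  rfl

/-- for `k ≥ 1` and every ordinal tree `t`, the kth-order
shape entropy of `t` equals `lg (1 / P_{ζ^{ϑ^t}}[t])`, where `ϑ^t` is the
empirical kth-order shape process of `FCNS⋄(t)` and `ζ^{ϑ^t}` the derived
(k−1)st-order childtype process. -/
theorem statement16 (k : ℕ) (hk : 1 ≤ k) (t : OrdTree) :
    shapeEntropy k (fcnsStar [t]) =
      Real.logb 2 (1 /
        childtypeProb (k - 1)
          (empShape k (fcnsStar [t]) (List.replicate k false) 2)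
          (derivedZeta (empShape k (fcnsStar [t])))
          (fcnsStar [t])) := by
  obtain ⟨f⟩ := t
  rw [shapeEntropy_eq k hk, one_div, Real.logb_inv, shapeProb, shapeProbAux_eq]
  · simp [fcnsStar, childtypeProb, rootType]
  · intro h
    simp at h
    omega
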